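/- arXiv:2502.02989 — 2 statements merged into one kernel-verified Lean document; each statement's English description precedes it below -/
import Mathlib

section
/- Let F ⊂ ℝⁿ be the self-similar set of an iterated function system S₁, …, S_N of contracting similarities with ratios r₁, …, r_N ∈ (0,1) satisfying the open set condition, and let d solve Σᵢ rᵢ^d = 1. Then F is a d-set: there exist positive constants c_F, C_F such that c_F r^d ≤ H^d(F ∩ B(x, r)) ≤ C_F r^d for all x ∈ F and all r ∈ (0, |O|), where O is a feasible open set and |O| its diameter. -/
open MeasureTheory Metric

namespace DSet
open Set Module
open scoped ENNReal NNReal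

set_option linter.unusedSectionVars false

variable {E : Type*} [NormedAddCommGroup E] [NormedSpace ℝ E] [FiniteDimensional ℝ E]
  [MeasurableSpace E] [BorelSpace E]

lemma lip {f : E → E} {c : ℝ} (hc : 0 < c) (h : ∀ x y, dist (f x) (f y) = c * dist x y) :
    LipschitzWith c.toNNReal f :=
  LipschitzWith.of_dist_le_mul fun x y => by rw [h, Real.coe_toNNReal _ hc.le]

lemma antilip {f : E → E} {c : ℝ} (hc : 0 < c) (h : ∀ x y, dist (f x) (f y) = c * dist x y) :
    AntilipschitzWith (c⁻¹).toNNReal f :=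
  AntilipschitzWith.of_le_mul_dist fun x y => by
    rw [h, Real.coe_toNNReal _ (inv_pos.2 hc).le, ← mul_assoc, inv_mul_cancel₀ hc.ne', one_mul]

lemma memb {f : E → E} {c : ℝ} (hc : 0 < c) (h : ∀ x y, dist (f x) (f y) = c * dist x y) :
    MeasurableEmbedding f :=
  ((antilip hc h).isClosedEmbedding (lip hc h).uniformContinuous).measurableEmbedding

lemma haus_image {f : E → E} {c : ℝ} (hc : 0 < c) (h : ∀ x y, dist (f x) (f y) = c * dist x y)
    {s : ℝ} (hs : 0 ≤ s) (A : Set E) :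
    μH[s] (f '' A) = ENNReal.ofReal (c ^ s) * μH[s] A := by
  have e1 : ∀ {c : ℝ}, 0 < c → ((c.toNNReal : ℝ≥0) : ℝ≥0∞) ^ s = ENNReal.ofReal (c ^ s) := by
    intro c hc
    rw [← ENNReal.ofReal_rpow_of_pos hc]; rfl
  apply le_antisymm
  · have := (lip hc h).hausdorffMeasure_image_le hs A
    rwa [e1 hc] at this
  · have := (antilip hc h).le_hausdorffMeasure_image hs A
    rw [e1 (inv_pos.2 hc)] at this
    calc _ ≤ ENNReal.ofReal (c ^ s) * (ENNReal.ofReal (c⁻¹ ^ s) * μH[s] (f '' A)) := by gcongr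
      _ = _ := by
        rw [← mul_assoc, ← ENNReal.ofReal_mul (by positivity), ← Real.mul_rpow hc.le (by positivity),
          mul_inv_cancel₀ hc.ne']
        simp

/-- the key estimate -/
lemma key {N : ℕ} {S : Fin N → E → E} {r : Fin N → ℝ} {a b : ℝ} (ha : 0 < a)
    (har : ∀ i, a ≤ r i) (hbr : ∀ i, r i ≤ b)
    (hsim : ∀ i x y, dist (S i x) (S i y) = r i * dist x y)
    {F O : Set E} (hO : IsOpen O)
    (hOSC₁ : (⋃ i, S i '' O) ⊆ O)
    (hOSC₂ : ∀ i j, i ≠ j → Disjoint (S i '' O) (S j '' O))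
    {d R : ℝ} (hR : 0 < R) (hRF : ∀ x ∈ F, ∀ y ∈ O, dist x y < R)
    {K C : ℝ≥0∞}
    (hC : ∀ δ, 1 ≤ δ → δ ≤ 1 / a →
      K ≤ C * ENNReal.ofReal (δ ^ (d - finrank ℝ E)) * μH[(finrank ℝ E : ℝ)] O)
    {T : ℕ → Set E → ℝ≥0∞} (hTK : ∀ m A, T m A ≤ K)
    (hT0 : ∀ m A, ¬ (A ∩ F).Nonempty → T m A = 0)
    (hTS : ∀ m A, T (m + 1) A ≤ ∑ i, ENNReal.ofReal (r i ^ d) * T m (S i ⁻¹' A))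
    (k : ℕ) : ∀ m, k ≤ m → ∀ δ, 0 < δ → b ^ k ≤ δ → δ ≤ 1 / a → ∀ A,
      T m A ≤ C * ENNReal.ofReal (δ ^ (d - finrank ℝ E)) *
        μH[(finrank ℝ E : ℝ)] (O ∩ thickening (R * δ) A) := by
  have base : ∀ m, ∀ δ, 1 ≤ δ → δ ≤ 1 / a → ∀ A,
      T m A ≤ C * ENNReal.ofReal (δ ^ (d - finrank ℝ E)) *
        μH[(finrank ℝ E : ℝ)] (O ∩ thickening (R * δ) A) := by
    intro m δ h1 h2 A
    by_cases hA : (A ∩ F).Nonempty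
    · obtain ⟨x, hxA, hxF⟩ := hA
      have : O ∩ thickening (R * δ) A = O := by
        apply inter_eq_left.2
        intro y hy
        rw [mem_thickening_iff]
        refine ⟨x, hxA, ?_⟩
        rw [dist_comm]
        exact (hRF x hxF y hy).trans_le (le_mul_of_one_le_right hR.le h1)
      rw [this]
      exact (hTK m A).trans (hC δ h1 h2)
    · rw [hT0 m A hA]; exact zero_le
  induction k with
  | zero =>
    intro m _ δ _ h1 h2 A
    exact base m δ (by simpa using h1) h2 A
  | succ k ih =>
    intro m hm δ hδ h1 h2 A
    rcases le_or_gt 1 δ with h | h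
    · exact base m δ h h2 A
    obtain ⟨m, rfl⟩ : ∃ m', m = m' + 1 := ⟨m - 1, by omega⟩
    have hr0 : ∀ i, 0 < r i := fun i => ha.trans_le (har i)
    set X : Fin N → Set E := fun i => O ∩ thickening (R * (δ / r i)) (S i ⁻¹' A) with hX
    have hXm : ∀ i, MeasurableSet (X i) := fun i =>
      (hO.inter isOpen_thickening).measurableSet
    calc T (m + 1) A ≤ ∑ i, ENNReal.ofReal (r i ^ d) * T m (S i ⁻¹' A) := hTS m A
      _ ≤ ∑ i, ENNReal.ofReal (r i ^ d) * (C * ENNReal.ofReal ((δ / r i) ^ (d - finrank ℝ E)) *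
          μH[(finrank ℝ E : ℝ)] (X i)) := by
        gcongr with i _
        refine ih m (by omega) (δ / r i) (div_pos hδ (hr0 i)) ?_ ?_ _
        · rw [le_div_iff₀ (hr0 i)]
          have hb : 0 < b := (hr0 i).trans_le (hbr i)
          calc b ^ k * r i ≤ b ^ k * b := by gcongr; exact hbr i
            _ = b ^ (k + 1) := by ring
            _ ≤ δ := h1
        · exact div_le_div₀ zero_le_one h.le ha (har i)
      _ = ∑ i, C * ENNReal.ofReal (δ ^ (d - finrank ℝ E)) *
          μH[(finrank ℝ E : ℝ)] (S i '' X i) := by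
        refine Finset.sum_congr rfl fun i _ => ?_
        rw [haus_image (hr0 i) (hsim i) (by positivity)]
        have : ENNReal.ofReal (r i ^ d) * ENNReal.ofReal ((δ / r i) ^ (d - finrank ℝ E)) =
            ENNReal.ofReal (δ ^ (d - finrank ℝ E)) * ENNReal.ofReal (r i ^ (finrank ℝ E : ℝ)) := by
          rw [← ENNReal.ofReal_mul (Real.rpow_nonneg (hr0 i).le _),
            ← ENNReal.ofReal_mul (Real.rpow_nonneg hδ.le _), Real.div_rpow hδ.le (hr0 i).le,
            Real.rpow_sub (hr0 i)]
          congr 1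
          have h1 := Real.rpow_pos_of_pos (hr0 i) d
          have h2 := Real.rpow_pos_of_pos (hr0 i) (finrank ℝ E : ℝ)
          field_simp
        calc _ = C * (ENNReal.ofReal (r i ^ d) * ENNReal.ofReal ((δ / r i) ^ (d - finrank ℝ E)))
              * μH[(finrank ℝ E : ℝ)] (X i) := by ring
          _ = _ := by rw [this]; ring
      _ = C * ENNReal.ofReal (δ ^ (d - finrank ℝ E)) *
          μH[(finrank ℝ E : ℝ)] (⋃ i, S i '' X i) := by
        rw [measure_iUnion, tsum_fintype, Finset.mul_sum]
        · intro i j hij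
          exact (hOSC₂ i j hij).mono (image_mono inter_subset_left) (image_mono inter_subset_left)
        · exact fun i => (memb (hr0 i) (hsim i)).measurableSet_image.2 (hXm i)
      _ ≤ _ := by
        gcongr
        refine iUnion_subset fun i => subset_inter ?_ ?_
        · exact (image_mono inter_subset_left).trans ((subset_iUnion (fun i => S i '' O) i).trans hOSC₁)
        · rintro _ ⟨y, ⟨_, hy⟩, rfl⟩
          rw [mem_thickening_iff] at hy ⊢
          obtain ⟨z, hz, hyz⟩ := hy
          refine ⟨S i z, hz, ?_⟩
          rw [hsim]
          calc r i * dist y z < r i * (R * (δ / r i)) := by gcongr; exact hr0 i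
            _ = R * δ := by have := (hr0 i).ne'; field_simp

/-- uniform form of the key estimate -/
lemma key2 {N : ℕ} {S : Fin N → E → E} {r : Fin N → ℝ} {a b : ℝ} (ha : 0 < a) (ha1 : a ≤ 1)
    (hb : b < 1) (hb0 : 0 < b)
    (har : ∀ i, a ≤ r i) (hbr : ∀ i, r i ≤ b)
    (hsim : ∀ i x y, dist (S i x) (S i y) = r i * dist x y)
    {F O : Set E} (hF : Bornology.IsBounded F) (hO : IsOpen O) (hOne : O.Nonempty)
    (hOb : Bornology.IsBounded O)
    (hOSC₁ : (⋃ i, S i '' O) ⊆ O)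
    (hOSC₂ : ∀ i j, i ≠ j → Disjoint (S i '' O) (S j '' O)) (d : ℝ) :
    ∃ C : ℝ≥0∞, C ≠ ∞ ∧ ∀ (K : ℝ≥0∞) (T : ℕ → Set E → ℝ≥0∞), (∀ m A, T m A ≤ K) →
    (∀ m A, ¬ (A ∩ F).Nonempty → T m A = 0) →
    (∀ m A, T (m + 1) A ≤ ∑ i, ENNReal.ofReal (r i ^ d) * T m (S i ⁻¹' A)) →
    ∀ δ, 0 < δ → δ ≤ 1 → ∃ M, ∀ m, M ≤ m → ∀ x A, A ⊆ closedBall x δ →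
      T m A ≤ K * C * ENNReal.ofReal (δ ^ d) := by
  obtain ⟨R, hR, hRF⟩ : ∃ R : ℝ, 0 < R ∧ ∀ x ∈ F, ∀ y ∈ O, dist x y < R := by
    obtain ⟨R, hR⟩ := (Metric.isBounded_iff.1 (hF.union hOb))
    refine ⟨max R 0 + 1, by positivity, fun x hx y hy => ?_⟩
    have := hR (Or.inl hx) (Or.inr hy)
    exact this.trans_lt ((le_max_left _ _).trans_lt (lt_add_one _))
  set n := finrank ℝ E
  set V : Measure E := μH[(n : ℝ)]
  have hV0 : V O ≠ 0 := (hO.measure_pos V hOne).ne'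
  have hVt : V O ≠ ∞ := hOb.measure_lt_top.ne
  set B : ℝ := (1 / a) ^ |(n : ℝ) - d|
  have hB : 0 < B := by positivity
  set C0 : ℝ≥0∞ := ENNReal.ofReal B * (V O)⁻¹
  have hC0 : C0 ≠ ∞ := ENNReal.mul_ne_top ENNReal.ofReal_ne_top (ENNReal.inv_ne_top.2 hV0)
  refine ⟨C0 * ENNReal.ofReal ((R + 1) ^ n) * V (closedBall 0 1), ?_, ?_⟩
  · exact ENNReal.mul_ne_top (ENNReal.mul_ne_top hC0 ENNReal.ofReal_ne_top)
      (isCompact_closedBall _ _).measure_lt_top.ne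
  intro K T hTK hT0 hTS δ hδ hδ1
  have hC : ∀ δ, 1 ≤ δ → δ ≤ 1 / a →
      K ≤ (K * C0) * ENNReal.ofReal (δ ^ (d - n)) * V O := by
    intro δ h1 h2
    have h0 : 0 < δ := by linarith
    have e : (K * C0) * ENNReal.ofReal (δ ^ (d - n)) * V O =
        K * ENNReal.ofReal (B * δ ^ (d - n)) := by
      rw [ENNReal.ofReal_mul hB.le]
      calc _ = K * (ENNReal.ofReal B * ENNReal.ofReal (δ ^ (d - n))) * ((V O)⁻¹ * V O) := by ring
        _ = _ := by rw [ENNReal.inv_mul_cancel hV0 hVt, mul_one]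
    rw [e]
    apply le_mul_of_one_le_right (zero_le)
    rw [ENNReal.one_le_ofReal]
    have : δ ^ ((n : ℝ) - d) ≤ B :=
      (Real.rpow_le_rpow_of_exponent_le h1 (le_abs_self _)).trans
        (Real.rpow_le_rpow h0.le h2 (abs_nonneg _))
    calc (1 : ℝ) = δ ^ ((n : ℝ) - d) * δ ^ (d - n) := by
          rw [← Real.rpow_add h0]; simp
      _ ≤ _ := by gcongr
  obtain ⟨M, hM⟩ := exists_pow_lt_of_lt_one hδ hb
  refine ⟨M, fun m hm x A hA => ?_⟩
  have h1a : 1 ≤ 1 / a := by rw [le_div_iff₀ ha]; linarith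
  refine (key ha har hbr hsim hO hOSC₁ hOSC₂ hR hRF hC hTK hT0 hTS M m hm δ hδ hM.le
    (hδ1.trans h1a) A).trans ?_
  have hsub : O ∩ thickening (R * δ) A ⊆ closedBall x ((R + 1) * δ) := by
    rintro y ⟨_, hy⟩
    obtain ⟨z, hz, hyz⟩ := mem_thickening_iff.1 hy
    have := hA hz
    rw [mem_closedBall] at this ⊢
    linarith [dist_triangle y z x]
  calc _ ≤ (K * C0) * ENNReal.ofReal (δ ^ (d - n)) * V (closedBall x ((R + 1) * δ)) := by gcongr
    _ = K * (C0 * ENNReal.ofReal ((R + 1) ^ n) * V (closedBall 0 1)) *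
        (ENNReal.ofReal (δ ^ (d - n)) * ENNReal.ofReal (δ ^ n)) := by
      rw [Measure.addHaar_closedBall' V x (by positivity), mul_pow,
        ENNReal.ofReal_mul (by positivity)]
      ring
    _ = _ := by
      rw [← ENNReal.ofReal_mul (by positivity), ← Real.rpow_natCast δ, ← Real.rpow_add hδ]
      simp


/-- finiteness -/
lemma cover {N : ℕ} {S : Fin N → E → E} {r : Fin N → ℝ} (hr0 : ∀ i, 0 < r i)
    (hsim : ∀ i x y, dist (S i x) (S i y) = r i * dist x y)
    {F : Set E} (hFinv : F = ⋃ i, S i '' F) (m : ℕ) :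
    ∃ t : (Fin m → Fin N) → Set E, F ⊆ ⋃ w, t w ∧
      ∀ w, ediam (t w) ≤ (∏ j, ENNReal.ofReal (r (w j))) * ediam F := by
  induction m with
  | zero => exact ⟨fun _ => F, fun x hx => by simpa using hx, fun w => by simp⟩
  | succ m ih =>
    obtain ⟨t, ht, htd⟩ := ih
    refine ⟨fun w => S (w 0) '' t (Fin.tail w), ?_, fun w => ?_⟩
    · intro x hx
      rw [hFinv] at hx
      obtain ⟨i, y, hy, rfl⟩ := mem_iUnion.1 hx
      obtain ⟨w, hw⟩ := mem_iUnion.1 (ht hy)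
      refine mem_iUnion.2 ⟨Fin.cons i w, ?_⟩
      simp only [Fin.cons_zero, Fin.tail_cons]
      exact mem_image_of_mem _ hw
    · refine ((lip (hr0 _) (hsim (w 0))).ediam_image_le _).trans ?_
      rw [Fin.prod_univ_succ, mul_assoc]
      exact mul_le_mul' le_rfl (htd (Fin.tail w))

lemma finite {N : ℕ} {S : Fin N → E → E} {r : Fin N → ℝ} {b : ℝ}
    (hb : b < 1) (hr0 : ∀ i, 0 < r i) (hbr : ∀ i, r i ≤ b)
    (hsim : ∀ i x y, dist (S i x) (S i y) = r i * dist x y)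
    {F : Set E} (hF : Bornology.IsBounded F) (hFinv : F = ⋃ i, S i '' F)
    {d : ℝ} (hd0 : 0 ≤ d) (hd : ∑ i, (r i) ^ d = 1) : μH[d] F ≠ ∞ := by
  choose t ht htd using fun m => cover hr0 hsim hFinv m
  have hFd : ediam F ≠ ∞ := hF.ediam_ne_top
  have hlim : Filter.Tendsto (fun m : ℕ => (ENNReal.ofReal b) ^ m * ediam F) Filter.atTop
      (nhds 0) := by
    have h1 : ENNReal.ofReal b < 1 := by simpa using hb
    have := ENNReal.Tendsto.mul_const (ENNReal.tendsto_pow_atTop_nhds_zero_of_lt_one h1)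
      (b := ediam F) (Or.inr hFd)
    simpa using this
  have hle := Measure.hausdorffMeasure_le_liminf_sum d F
    (fun m : ℕ => (ENNReal.ofReal b) ^ m * ediam F) hlim t
    (Filter.Eventually.of_forall fun m w => by
      refine (htd m w).trans ?_
      gcongr
      calc _ ≤ ∏ _j : Fin m, ENNReal.ofReal b :=
            Finset.prod_le_prod' fun j _ => ENNReal.ofReal_le_ofReal (hbr _)
        _ = _ := by simp)
    (Filter.Eventually.of_forall ht)
  have hsum : ∀ m, ∑ w, ediam (t m w) ^ d ≤ ediam F ^ d := by
    intro m
    calc ∑ w, ediam (t m w) ^ d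
        ≤ ∑ w : Fin m → Fin N, (∏ j, ENNReal.ofReal (r (w j) ^ d)) * ediam F ^ d := by
          gcongr with w
          refine (ENNReal.rpow_le_rpow (htd m w) hd0).trans ?_
          rw [ENNReal.mul_rpow_of_nonneg _ _ hd0, ← ENNReal.prod_rpow_of_nonneg hd0]
          simp_rw [ENNReal.ofReal_rpow_of_pos (hr0 _)]
          exact le_rfl
      _ = (∑ i, ENNReal.ofReal (r i ^ d)) ^ m * ediam F ^ d := by
          rw [← Finset.sum_mul, Fintype.sum_pow]
      _ = ediam F ^ d := by
          rw [← ENNReal.ofReal_sum_of_nonneg (fun i _ => Real.rpow_nonneg (hr0 i).le _), hd]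
          simp
  refine ne_top_of_le_ne_top (ENNReal.rpow_ne_top_of_nonneg hd0 hFd) (hle.trans ?_)
  refine Filter.liminf_le_of_le ?_ ?_
  · isBoundedDefault
  · intro c hc
    obtain ⟨m, hm⟩ := hc.exists
    exact hm.trans (hsum m)

open Classical in
/-- the discrete mass functionals -/
noncomputable def T {N : ℕ} (S : Fin N → E → E) (p : Fin N → ℝ≥0∞) (F : Set E) :
    ℕ → Set E → ℝ≥0∞
  | 0, A => if (A ∩ F).Nonempty then 1 else 0
  | m + 1, A => ∑ i, p i * T S p F m (S i ⁻¹' A)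

section T
variable {N : ℕ} {S : Fin N → E → E} {p : Fin N → ℝ≥0∞} {F : Set E}

lemma T_le (hp : ∑ i, p i = 1) (m : ℕ) : ∀ A, T S p F m A ≤ 1 := by
  induction m with
  | zero => intro A; simp only [T]; split_ifs <;> simp
  | succ m ih =>
    intro A
    simp only [T]
    calc _ ≤ ∑ i, p i * 1 := by gcongr; exact ih _
      _ = 1 := by simp [hp]

lemma T_zero (hF : ∀ i, ∀ x ∈ F, S i x ∈ F) (m : ℕ) :
    ∀ A, ¬ (A ∩ F).Nonempty → T S p F m A = 0 := by
  induction m with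
  | zero => intro A hA; simp only [T]; rw [if_neg hA]
  | succ m ih =>
    intro A hA
    simp only [T]
    refine Finset.sum_eq_zero fun i _ => ?_
    rw [ih, mul_zero]
    rintro ⟨x, hx, hxF⟩
    exact hA ⟨S i x, hx, hF i x hxF⟩

lemma T_one (hp : ∑ i, p i = 1) (hF : ∀ i, ∀ x ∈ F, S i x ∈ F) (hne : F.Nonempty) (m : ℕ) :
    ∀ A, F ⊆ A → T S p F m A = 1 := by
  induction m with
  | zero =>
    intro A hA; simp only [T]; rw [if_pos]
    rwa [inter_eq_right.2 hA]
  | succ m ih =>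
    intro A hA
    simp only [T]
    rw [← hp]
    refine Finset.sum_congr rfl fun i _ => ?_
    rw [ih, mul_one]
    exact fun x hx => hA (hF i x hx)

lemma T_sub {ι : Type*} (s : Finset ι) (m : ℕ) :
    ∀ U : ι → Set E, T S p F m (⋃ k ∈ s, U k) ≤ ∑ k ∈ s, T S p F m (U k) := by
  induction m with
  | zero =>
    intro U
    simp only [T]
    split_ifs with h
    · obtain ⟨x, hx, hxF⟩ := h
      simp only [mem_iUnion] at hx
      obtain ⟨k, hk, hxk⟩ := hx
      have h1 : (U k ∩ F).Nonempty := ⟨x, hxk, hxF⟩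
      refine le_trans ?_ (Finset.single_le_sum (fun _ _ => zero_le) hk)
      rw [if_pos h1]
    · exact zero_le
  | succ m ih =>
    intro U
    simp only [T]
    rw [Finset.sum_comm]
    gcongr with i
    rw [← Finset.mul_sum]
    gcongr
    simp only [preimage_iUnion]
    exact ih _
end T

lemma pos {N : ℕ} {S : Fin N → E → E} {r : Fin N → ℝ} {a b : ℝ} (ha : 0 < a) (ha1 : a ≤ 1)
    (hb : b < 1) (hb0 : 0 < b)
    (har : ∀ i, a ≤ r i) (hbr : ∀ i, r i ≤ b)
    (hsim : ∀ i x y, dist (S i x) (S i y) = r i * dist x y)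
    {F O : Set E} (hF : IsCompact F) (hne : F.Nonempty) (hFinv : F = ⋃ i, S i '' F)
    (hO : IsOpen O) (hOne : O.Nonempty)
    (hOb : Bornology.IsBounded O)
    (hOSC₁ : (⋃ i, S i '' O) ⊆ O)
    (hOSC₂ : ∀ i j, i ≠ j → Disjoint (S i '' O) (S j '' O)) {d : ℝ}
    (hd0 : 0 ≤ d) (hd : ∑ i, (r i) ^ d = 1) : μH[d] F ≠ 0 := by
  intro hzero
  have hr0 : ∀ i, 0 < r i := fun i => ha.trans_le (har i)
  obtain ⟨C, hC, hCT⟩ := key2 ha ha1 hb hb0 har hbr hsim hF.isBounded hO hOne hOb hOSC₁ hOSC₂ d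
  set p : Fin N → ℝ≥0∞ := fun i => ENNReal.ofReal (r i ^ d)
  have hp : ∑ i, p i = 1 := by
    rw [← ENNReal.ofReal_sum_of_nonneg (fun i _ => Real.rpow_nonneg (hr0 i).le _), hd]
    simp
  have hFS : ∀ i, ∀ x ∈ F, S i x ∈ F := by
    intro i x hx
    rw [hFinv]
    exact mem_iUnion.2 ⟨i, mem_image_of_mem _ hx⟩
  have hT := hCT 1 (T S p F) (T_le hp) (T_zero hFS) (fun m A => le_of_eq rfl)
  -- choose ε
  obtain ⟨ε, hε0, hε⟩ : ∃ ε : ℝ≥0∞, ε ≠ 0 ∧ C * (ε + ε) < 1 := by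
    refine ⟨(4 * (C + 1))⁻¹, ENNReal.inv_ne_zero.2 (by finiteness), ?_⟩
    have h1 : (4 * (C + 1)) ≠ 0 := by simp
    have h2 : (4 * (C + 1)) ≠ ∞ := by finiteness
    rw [← two_mul, ← mul_assoc, ← div_eq_mul_inv, ENNReal.div_lt_iff (Or.inl h1) (Or.inl h2)]
    lift C to ℝ≥0 using hC
    norm_cast
    rw [← NNReal.coe_lt_coe]
    push_cast
    have := C.coe_nonneg
    linarith
  rw [Measure.hausdorffMeasure_apply] at hzero
  have h2 : (⨅ (t : ℕ → Set E) (_ : F ⊆ ⋃ n, t n) (_ : ∀ n, ediam (t n) ≤ ENNReal.ofReal (1/2)),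
          ∑' n, ⨆ _ : (t n).Nonempty, ediam (t n) ^ d) < ε := by
    refine lt_of_le_of_lt ?_ (pos_iff_ne_zero.2 hε0)
    rw [← hzero]
    exact le_iSup₂_of_le (ENNReal.ofReal (1/2)) (by simp) le_rfl
  simp only [iInf_lt_iff] at h2
  obtain ⟨t, htF, htd, hts⟩ := h2
  obtain ⟨η, hη, hηs⟩ := ENNReal.exists_pos_sum_of_countable' hε0 ℕ
  have hball : ∀ n, ∃ U : Set E, IsOpen U ∧ t n ⊆ U ∧ ∃ M, ∀ m, M ≤ m →
      T S p F m U ≤ C * ((⨆ _ : (t n).Nonempty, ediam (t n) ^ d) + η n) := by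
    intro n
    rcases (t n).eq_empty_or_nonempty with h | h
    · refine ⟨∅, isOpen_empty, h.subset, 0, fun m _ => ?_⟩
      rw [T_zero hFS m ∅ (by simp)]
      exact zero_le
    have hfin : ediam (t n) ≠ ∞ := ne_top_of_le_ne_top ENNReal.ofReal_ne_top (htd n)
    set D : ℝ := (ediam (t n)).toReal
    have hD0 : 0 ≤ D := ENNReal.toReal_nonneg
    have hD : D ≤ 1 / 2 := ENNReal.toReal_le_of_le_ofReal (by norm_num) (htd n)
    have hDe : ediam (t n) = ENNReal.ofReal D := (ENNReal.ofReal_toReal hfin).symm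
    have hcont : ContinuousAt (fun δ : ℝ => ENNReal.ofReal (δ ^ d)) D :=
      ENNReal.continuous_ofReal.continuousAt.comp
        (Real.continuousAt_rpow_const D d (Or.inr hd0))
    have hlt : ENNReal.ofReal (D ^ d) < ENNReal.ofReal (D ^ d) + η n :=
      ENNReal.lt_add_right ENNReal.ofReal_ne_top (hη n).ne'
    have hev := hcont.eventually (gt_mem_nhds hlt)
    have hev2 : ∀ᶠ δ in nhdsWithin D (Ioi D), ENNReal.ofReal (δ ^ d) < ENNReal.ofReal (D ^ d) + η n
        ∧ δ < 1 ∧ D < δ :=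
      (hev.filter_mono nhdsWithin_le_nhds).and
        (((gt_mem_nhds (show D < 1 by linarith)).filter_mono nhdsWithin_le_nhds).and
          self_mem_nhdsWithin)
    obtain ⟨δ, h1, hδ1, hDδ⟩ := hev2.exists
    obtain ⟨x, hx⟩ := h
    obtain ⟨M, hM⟩ := hT δ (hD0.trans_lt hDδ) hδ1.le
    refine ⟨ball x δ, isOpen_ball, ?_, M, fun m hm => ?_⟩
    · intro y hy
      have := edist_le_ediam_of_mem hy hx
      rw [hDe, edist_dist, ENNReal.ofReal_le_ofReal_iff hD0] at this
      exact mem_ball.2 (this.trans_lt hDδ)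
    · refine (hM m hm x _ ball_subset_closedBall).trans ?_
      rw [one_mul]
      gcongr
      rw [iSup_pos ⟨x, hx⟩, hDe]
      refine h1.le.trans (le_of_eq ?_)
      congr 1
      exact (ENNReal.ofReal_rpow_of_nonneg hD0 hd0).symm
  choose U hUo htU M hM using hball
  obtain ⟨s, hs⟩ := hF.elim_finite_subcover U hUo (htF.trans (iUnion_mono htU))
  have h1 : T S p F (s.sup M) (⋃ k ∈ s, U k) = 1 := T_one hp hFS hne _ _ hs
  refine lt_irrefl (1 : ℝ≥0∞) ?_
  calc (1 : ℝ≥0∞) = T S p F (s.sup M) (⋃ k ∈ s, U k) := h1.symm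
    _ ≤ ∑ k ∈ s, T S p F (s.sup M) (U k) := T_sub _ _ _
    _ ≤ ∑ k ∈ s, C * ((⨆ _ : (t k).Nonempty, ediam (t k) ^ d) + η k) :=
      Finset.sum_le_sum fun k hk => hM k _ (Finset.le_sup hk)
    _ ≤ ∑' k, C * ((⨆ _ : (t k).Nonempty, ediam (t k) ^ d) + η k) := ENNReal.sum_le_tsum _
    _ = C * ((∑' k, ⨆ _ : (t k).Nonempty, ediam (t k) ^ d) + ∑' k, η k) := by
      rw [ENNReal.tsum_mul_left, ENNReal.tsum_add]
    _ ≤ C * (ε + ε) := by gcongr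
    _ < 1 := hε

lemma lower {N : ℕ} {S : Fin N → E → E} {r : Fin N → ℝ} {a b D d : ℝ} (ha : 0 < a)
    (har : ∀ i, a ≤ r i) (hbr : ∀ i, r i ≤ b)
    (hsim : ∀ i x y, dist (S i x) (S i y) = r i * dist x y)
    {F : Set E} (hFinv : F = ⋃ i, S i '' F) (hd0 : 0 ≤ d) (hD : 0 < D)
    (hFD : ∀ x ∈ F, ∀ y ∈ F, dist x y ≤ D) (k : ℕ) :
    ∀ ρ, b ^ k * D ≤ ρ → 0 < ρ → ρ ≤ D / a → ∀ x ∈ F,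
      μH[d] F * ENNReal.ofReal ((a / D) ^ d * ρ ^ d) ≤ μH[d] (F ∩ closedBall x ρ) := by
  have base : ∀ ρ, D ≤ ρ → 0 < ρ → ρ ≤ D / a → ∀ x ∈ F,
      μH[d] F * ENNReal.ofReal ((a / D) ^ d * ρ ^ d) ≤ μH[d] (F ∩ closedBall x ρ) := by
    intro ρ h1 h0 h2 x hx
    have : F ∩ closedBall x ρ = F :=
      inter_eq_left.2 fun y hy => mem_closedBall.2 ((hFD y hy x hx).trans h1)
    rw [this]
    apply mul_le_of_le_one_right zero_le
    rw [ENNReal.ofReal_le_one, ← Real.mul_rpow (by positivity) h0.le]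
    apply Real.rpow_le_one (by positivity) _ hd0
    rw [le_div_iff₀ ha] at h2
    rw [div_mul_eq_mul_div, div_le_one hD]
    linarith
  induction k with
  | zero => intro ρ h1; exact base ρ (by simpa using h1)
  | succ k ih =>
    intro ρ h1 h0 h2 x hx
    rcases le_or_gt D ρ with h | h
    · exact base ρ h h0 h2 x hx
    have hx' := hx
    rw [hFinv] at hx'
    obtain ⟨i, y, hy, rfl⟩ := mem_iUnion.1 hx'
    have hri : 0 < r i := ha.trans_le (har i)
    have hb : 0 < b := hri.trans_le (hbr i)
    have hih := ih (ρ / r i) (by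
      rw [le_div_iff₀ hri]
      calc b ^ k * D * r i ≤ b ^ k * D * b := by gcongr; exact hbr i
        _ = b ^ (k + 1) * D := by ring
        _ ≤ ρ := h1) (div_pos h0 hri) (div_le_div₀ hD.le h.le ha (har i)) y hy
    calc _ = ENNReal.ofReal (r i ^ d) *
          (μH[d] F * ENNReal.ofReal ((a / D) ^ d * (ρ / r i) ^ d)) := by
          rw [mul_left_comm, ← ENNReal.ofReal_mul (by positivity), Real.div_rpow h0.le hri.le]
          congr 2
          have := Real.rpow_pos_of_pos hri d
          field_simp
      _ ≤ ENNReal.ofReal (r i ^ d) * μH[d] (F ∩ closedBall y (ρ / r i)) := by gcongr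
      _ = μH[d] (S i '' (F ∩ closedBall y (ρ / r i))) := (haus_image hri (hsim i) hd0 _).symm
      _ ≤ _ := by
        apply measure_mono
        rintro _ ⟨z, ⟨hz, hzy⟩, rfl⟩
        refine ⟨?_, ?_⟩
        · rw [hFinv]; exact mem_iUnion.2 ⟨i, mem_image_of_mem _ hz⟩
        · rw [mem_closedBall] at hzy ⊢
          rw [hsim]
          calc r i * dist z y ≤ r i * (ρ / r i) := by gcongr
            _ = ρ := by field_simp

lemma main {N : ℕ} (hN : 0 < N) {S : Fin N → E → E} {r : Fin N → ℝ}
    (hr : ∀ i, r i ∈ Set.Ioo (0 : ℝ) 1)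
    (hsim : ∀ i x y, dist (S i x) (S i y) = r i * dist x y)
    {F O : Set E} (hF : IsCompact F) (hne : F.Nonempty) (hFinv : F = ⋃ i, S i '' F)
    (hO : IsOpen O) (hOne : O.Nonempty)
    (hOb : Bornology.IsBounded O)
    (hOSC₁ : (⋃ i, S i '' O) ⊆ O)
    (hOSC₂ : ∀ i j, i ≠ j → Disjoint (S i '' O) (S j '' O)) {d : ℝ}
    (hd : ∑ i, (r i) ^ d = 1) (L : ℝ) :
    ∃ cF CF : ℝ, 0 < cF ∧ 0 < CF ∧ ∀ x ∈ F, ∀ ρ ∈ Set.Ioo (0 : ℝ) L,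
      cF * ρ ^ d ≤ (μH[d] (F ∩ closedBall x ρ)).toReal ∧
      (μH[d] (F ∩ closedBall x ρ)).toReal ≤ CF * ρ ^ d := by
  haveI : Nonempty (Fin N) := ⟨⟨0, hN⟩⟩
  obtain ⟨i₀, hi₀⟩ := Finite.exists_min r
  obtain ⟨i₁, hi₁⟩ := Finite.exists_max r
  have hr0 : ∀ i, 0 < r i := fun i => (hr i).1
  have ha := (hr i₀).1
  have ha1 := (hr i₀).2.le
  have hb0 := (hr i₁).1
  have hb := (hr i₁).2
  have hd0 : 0 ≤ d := by
    by_contra hneg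
    push Not at hneg
    have h1 : 1 < r i₀ ^ d := Real.one_lt_rpow_of_pos_of_lt_one_of_neg ha (hr i₀).2 hneg
    have h2 : r i₀ ^ d ≤ ∑ i, r i ^ d :=
      Finset.single_le_sum (f := fun i => r i ^ d)
        (fun i _ => Real.rpow_nonneg (hr0 i).le _) (Finset.mem_univ i₀)
    linarith
  have hfin := finite hb hr0 hi₁ hsim hF.isBounded hFinv hd0 hd
  have hpos := pos ha ha1 hb hb0 hi₀ hi₁ hsim hF hne hFinv hO hOne hOb hOSC₁ hOSC₂ hd0 hd
  obtain ⟨C, hC, hCT⟩ := key2 ha ha1 hb hb0 hi₀ hi₁ hsim hF.isBounded hO hOne hOb hOSC₁ hOSC₂ d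
  have hHpos : 0 < (μH[d] F).toReal := ENNReal.toReal_pos hpos hfin
  obtain ⟨D, hD, hLD, hFD⟩ : ∃ D : ℝ, 0 < D ∧ L ≤ D ∧ ∀ x ∈ F, ∀ y ∈ F, dist x y ≤ D := by
    obtain ⟨D, hD⟩ := Metric.isBounded_iff.1 hF.isBounded
    refine ⟨max (max D L) 1, by positivity, (le_max_right _ _).trans (le_max_left _ _),
      fun x hx y hy => (hD hx hy).trans ((le_max_left _ _).trans (le_max_left _ _))⟩
  have hT := hCT (μH[d] F) (fun _ A => μH[d] (A ∩ F)) (fun _ A => measure_mono inter_subset_right)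
    (fun _ A hA => by
      rw [not_nonempty_iff_eq_empty.1 hA, measure_empty])
    (fun _ A => by
      have hsub : A ∩ F ⊆ ⋃ i, S i '' (S i ⁻¹' A ∩ F) := by
        rintro x ⟨hxA, hxF⟩
        rw [hFinv] at hxF
        obtain ⟨i, y, hy, rfl⟩ := mem_iUnion.1 hxF
        exact mem_iUnion.2 ⟨i, mem_image_of_mem _ ⟨hxA, hy⟩⟩
      refine (measure_mono hsub).trans ((measure_iUnion_fintype_le _ _).trans (le_of_eq ?_))
      exact Finset.sum_congr rfl fun i _ => haus_image (hr0 i) (hsim i) hd0 _)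
  refine ⟨(μH[d] F).toReal * (r i₀ / D) ^ d, (μH[d] F).toReal * (C.toReal + 1), by positivity,
    by positivity, fun x hx ρ hρ => ⟨?_, ?_⟩⟩
  · obtain ⟨k, hk⟩ := exists_pow_lt_of_lt_one (div_pos hρ.1 hD) hb
    have h1 : D ≤ D / r i₀ := by rw [le_div_iff₀ ha]; nlinarith
    have := lower ha hi₀ hi₁ hsim hFinv hd0 hD hFD k ρ ((lt_div_iff₀ hD).1 hk).le hρ.1
      (hρ.2.le.trans (hLD.trans h1)) x hx
    have h2 := ENNReal.toReal_mono (ne_top_of_le_ne_top hfin (measure_mono inter_subset_left)) this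
    have hρ0 := hρ.1
    rw [ENNReal.toReal_mul, ENNReal.toReal_ofReal (by positivity)] at h2
    linarith
  · have hρ0 := hρ.1
    have hC0 : 0 ≤ C.toReal := ENNReal.toReal_nonneg
    have hρd : 0 < ρ ^ d := Real.rpow_pos_of_pos hρ0 d
    rcases le_or_gt ρ 1 with h | h
    · obtain ⟨M, hM⟩ := hT ρ hρ0 h
      have h1 := hM M le_rfl x (closedBall x ρ) subset_rfl
      rw [inter_comm] at h1
      have h2 := ENNReal.toReal_mono (by finiteness) h1
      rw [ENNReal.toReal_mul, ENNReal.toReal_mul, ENNReal.toReal_ofReal hρd.le] at h2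
      refine h2.trans ?_
      gcongr
      linarith
    · have h1 : (μH[d] (F ∩ closedBall x ρ)).toReal ≤ (μH[d] F).toReal :=
        ENNReal.toReal_mono hfin (measure_mono inter_subset_left)
      refine h1.trans ?_
      have h2 : 1 ≤ ρ ^ d := Real.one_le_rpow h.le hd0
      rw [mul_assoc]
      apply le_mul_of_one_le_right hHpos.le
      nlinarith

end DSet



/-- a self-similar set satisfying the open set condition is a d-set
(Ahlfors regular of dimension d), where d solves Σᵢ rᵢ^d = 1. -/
theorem self_similar_set_is_d_set {n N : ℕ} (hN : 0 < N)
    (S : Fin N → EuclideanSpace ℝ (Fin n) → EuclideanSpace ℝ (Fin n))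
    (r : Fin N → ℝ) (hr : ∀ i, r i ∈ Set.Ioo (0 : ℝ) 1)
    (hsim : ∀ i x y, dist (S i x) (S i y) = r i * dist x y)
    (F : Set (EuclideanSpace ℝ (Fin n))) (hFcomp : IsCompact F) (hFne : F.Nonempty)
    (hFinv : F = ⋃ i, S i '' F)
    (O : Set (EuclideanSpace ℝ (Fin n))) (hOopen : IsOpen O) (hOne : O.Nonempty)
    (hObdd : Bornology.IsBounded O)
    (hOSC₁ : (⋃ i, S i '' O) ⊆ O)
    (hOSC₂ : ∀ i j, i ≠ j → Disjoint (S i '' O) (S j '' O))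
    (d : ℝ) (hd : ∑ i, (r i) ^ d = 1) :
    ∃ cF CF : ℝ, 0 < cF ∧ 0 < CF ∧ ∀ x ∈ F, ∀ ρ ∈ Set.Ioo (0 : ℝ) (EMetric.diam O).toReal,
      cF * ρ ^ d ≤ (μH[d] (F ∩ closedBall x ρ)).toReal ∧
      (μH[d] (F ∩ closedBall x ρ)).toReal ≤ CF * ρ ^ d := by
  exact DSet.main hN hr hsim hFcomp hFne hFinv hOopen hOne hObdd hOSC₁ hOSC₂ hd _
end

section
/- Let N ≥ 1, r₁, …, r_N ∈ (0,1) with Σᵢ rᵢ^d = 1 for some d > 0, and let η := Σᵢ |ln rᵢ| rᵢ^d > 0. Suppose Z, z : ℝ → ℝ are measurable, vanish on (−∞, 0], z is bounded, |z(t)| ≤ c e^{−γt} for t > 0 with constants c, γ > 0, z is continuous Lebesgue-almost everywhere, and Z satisfies the renewal equation Z(t) = Σᵢ rᵢ^d Z(t − |ln rᵢ|) + z(t) for all t ∈ ℝ. If the numbers |ln r₁|, …, |ln r_N| generate a dense subgroup of ℝ (non-lattice case), then lim_{t→∞} Z(t) = (1/η) ∫₀^∞ z(t) dt. -/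
open MeasureTheory Filter

/-- comparison principle -/
lemma rn_cmp {ι : Type*} [Fintype ι] (p a : ι → ℝ) (hp : ∀ i, 0 < p i)
    (a0 A b : ℝ) (ha0 : 0 < a0) (ha : ∀ i, a0 ≤ a i) (hA : ∀ i, a i ≤ A)
    (D : ℝ → ℝ) (h0 : ∀ t, b - A ≤ t → t ≤ b → 0 ≤ D t)
    (h1 : ∀ t, b < t → ∑ i, p i * D (t - a i) ≤ D t) :
    ∀ t, b - A ≤ t → 0 ≤ D t := by
  have key : ∀ n : ℕ, ∀ t, b - A ≤ t → t ≤ b + n * a0 → 0 ≤ D t := by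
    intro n
    induction n with
    | zero => intro t h h'; exact h0 t h (by simpa using h')
    | succ n ih =>
      intro t h h'
      rcases le_or_gt t b with hb | hb
      · exact h0 t h hb
      · refine le_trans (Finset.sum_nonneg fun i _ => mul_nonneg (hp i).le ?_) (h1 t hb)
        push_cast at h'
        have := ha i
        have := hA i
        apply ih <;> linarith
  intro t ht
  obtain ⟨n, hn⟩ := exists_nat_ge ((t - b) / a0)
  refine key n t ht ?_
  rw [div_le_iff₀ ha0] at hn
  linarith

lemma rn_bound1 {ι : Type*} [Fintype ι] [Nonempty ι] (p a : ι → ℝ) (hp : ∀ i, 0 < p i)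
    (hp1 : ∑ i, p i = 1)
    (a0 A : ℝ) (ha0 : 0 < a0) (ha : ∀ i, a0 ≤ a i) (hA : ∀ i, a i ≤ A) (γ b : ℝ) (hγ : 0 < γ) :
    ∃ K : ℝ, 0 ≤ K ∧ ∀ (C : ℝ) (f Y : ℝ → ℝ), 0 ≤ C → (∀ t ≤ b, Y t = 0) →
      (∀ t, b < t → f t ≤ C * Real.exp (-γ * t)) →
      (∀ t, b < t → Y t = ∑ i, p i * Y (t - a i) + f t) → ∀ t, Y t ≤ K * C := by
  set κ : ℝ := ∑ i, p i * Real.exp (γ * a i) - 1 with hκ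
  have hκ0 : 0 < κ := by
    have : ∑ i, p i * 1 < ∑ i, p i * Real.exp (γ * a i) := by
      apply Finset.sum_lt_sum_of_nonempty Finset.univ_nonempty
      intro i _
      apply mul_lt_mul_of_pos_left _ (hp i)
      exact Real.one_lt_exp_iff.2 (mul_pos hγ (lt_of_lt_of_le ha0 (ha i)))
    simp only [mul_one, hp1] at this
    linarith
  refine ⟨κ⁻¹ * Real.exp (-γ * (b - A)), by positivity, ?_⟩
  intro C f Y hC hY hf hE t
  have hcmp := rn_cmp p a hp a0 A b ha0 ha hA
    (fun t => κ⁻¹ * Real.exp (-γ * (b - A)) * C - κ⁻¹ * C * Real.exp (-γ * t) - Y t) ?_ ?_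
  · rcases le_or_gt t b with h | h
    · rw [hY t h]; positivity
    · have hAp : 0 < A := by
        obtain ⟨i⟩ := ‹Nonempty ι›
        linarith [ha i, hA i]
      have := hcmp t (by linarith)
      have h2 : 0 ≤ κ⁻¹ * C * Real.exp (-γ * t) := by positivity
      linarith
  · intro t h1 h2
    rw [hY t h2]
    have : Real.exp (-γ * t) ≤ Real.exp (-γ * (b - A)) := by
      apply Real.exp_le_exp.2; nlinarith
    have h3 : κ⁻¹ * C * Real.exp (-γ * t) ≤ κ⁻¹ * C * Real.exp (-γ * (b - A)) := by gcongr
    linarith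
  · intro t ht
    have e1 : ∑ i, p i * (κ⁻¹ * Real.exp (-γ * (b - A)) * C
        - κ⁻¹ * C * Real.exp (-γ * (t - a i)) - Y (t - a i))
        = κ⁻¹ * Real.exp (-γ * (b - A)) * C - κ⁻¹ * C * Real.exp (-γ * t) * (κ + 1)
          - ∑ i, p i * Y (t - a i) := by
      have e2 : κ + 1 = ∑ i, p i * Real.exp (γ * a i) := by rw [hκ]; ring
      rw [e2, Finset.mul_sum]
      have e4 : κ⁻¹ * Real.exp (-γ * (b - A)) * C
          = ∑ i, p i * (κ⁻¹ * Real.exp (-γ * (b - A)) * C) := by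
        rw [← Finset.sum_mul, hp1, one_mul]
      conv_rhs => rw [e4]
      rw [← Finset.sum_sub_distrib, ← Finset.sum_sub_distrib]
      apply Finset.sum_congr rfl
      intro i _
      have : Real.exp (-γ * (t - a i)) = Real.exp (-γ * t) * Real.exp (γ * a i) := by
        rw [← Real.exp_add]; ring_nf
      rw [this]; ring
    rw [e1, hE t ht]
    have := hf t ht
    have e3 : κ⁻¹ * C * Real.exp (-γ * t) * (κ + 1)
      = C * Real.exp (-γ * t) + κ⁻¹ * C * Real.exp (-γ * t) := by
      field_simp
    rw [e3]
    linarith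

lemma rn_bound {ι : Type*} [Fintype ι] [Nonempty ι] (p a : ι → ℝ) (hp : ∀ i, 0 < p i)
    (hp1 : ∑ i, p i = 1)
    (a0 A : ℝ) (ha0 : 0 < a0) (ha : ∀ i, a0 ≤ a i) (hA : ∀ i, a i ≤ A) (γ b : ℝ) (hγ : 0 < γ) :
    ∃ K : ℝ, 0 ≤ K ∧ ∀ (C : ℝ) (f Y : ℝ → ℝ), 0 ≤ C → (∀ t ≤ b, Y t = 0) →
      (∀ t, b < t → |f t| ≤ C * Real.exp (-γ * t)) →
      (∀ t, b < t → Y t = ∑ i, p i * Y (t - a i) + f t) → ∀ t, |Y t| ≤ K * C := by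
  obtain ⟨K, hK, h⟩ := rn_bound1 p a hp hp1 a0 A ha0 ha hA γ b hγ
  refine ⟨K, hK, fun C f Y hC hY hf hE t => abs_le'.2 ⟨?_, ?_⟩⟩
  · exact h C f Y hC hY (fun t ht => (le_abs_self _).trans (hf t ht)) hE t
  · refine h C (-f) (-Y) hC (fun t ht => by simp [hY t ht])
      (fun t ht => (neg_le_abs _).trans (hf t ht)) (fun t ht => ?_) t
    simp only [Pi.neg_apply, hE t ht, mul_neg, Finset.sum_neg_distrib]
    ring

/-- existence of a solution -/
lemma rn_exists {ι : Type*} [Fintype ι] (p a : ι → ℝ)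
    (a0 b : ℝ) (ha0 : 0 < a0) (ha : ∀ i, a0 ≤ a i) (f : ℝ → ℝ) (hf : ∀ t ≤ b, f t = 0) :
    ∃ Y : ℝ → ℝ, (∀ t ≤ b, Y t = 0) ∧ ∀ t, Y t = ∑ i, p i * Y (t - a i) + f t := by
  let F : ℕ → ℝ → ℝ := fun n => Nat.rec (fun _ => 0)
    (fun _ G t => ∑ i, p i * G (t - a i) + f t) n
  have F0 : ∀ t, F 0 t = 0 := fun t => rfl
  have FS : ∀ n t, F (n+1) t = ∑ i, p i * F n (t - a i) + f t := fun n t => rfl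
  have st : ∀ n : ℕ, ∀ t, t ≤ b + n * a0 → F (n+1) t = F n t := by
    intro n
    induction n with
    | zero =>
      intro t ht
      rw [FS]; simp only [F0]
      rw [hf t (by simpa using ht)]; simp
    | succ n ih =>
      intro t ht
      rw [FS (n+1), FS n]
      congr 1
      apply Finset.sum_congr rfl
      intro i _
      rw [ih]
      push_cast at ht
      linarith [ha i]
  have st2 : ∀ n m : ℕ, n ≤ m → ∀ t, t ≤ b + n * a0 → F m t = F n t := by
    intro n m hnm t ht
    induction m, hnm using Nat.le_induction with
    | base => rfl
    | succ m hm ih =>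
      rw [st m t, ih]
      have : (n:ℝ) ≤ m := by exact_mod_cast hm
      nlinarith
  have hex : ∀ t, ∃ n : ℕ, t ≤ b + n * a0 := by
    intro t
    obtain ⟨n, hn⟩ := exists_nat_ge ((t - b) / a0)
    refine ⟨n, ?_⟩
    rw [div_le_iff₀ ha0] at hn
    linarith
  choose ν hν using hex
  have hY : ∀ t (n : ℕ), t ≤ b + n * a0 → F (ν t) t = F n t := by
    intro t n hn
    rcases le_total n (ν t) with h | h
    · exact st2 _ _ h t hn
    · exact (st2 _ _ h t (hν t)).symm
  refine ⟨fun t => F (ν t) t, fun t ht => ?_, fun t => ?_⟩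
  · simp only
    rw [hY t 0 (by simpa using ht), F0]
  · simp only
    rw [← st _ t (hν t), FS]
    congr 1
    apply Finset.sum_congr rfl
    intro i _
    rw [hY (t - a i) (ν t)]
    linarith [hν t, ha i]

/-- conservation law -/
lemma rn_cons {ι : Type*} [Fintype ι] (p a : ι → ℝ) (hp1 : ∑ i, p i = 1)
    (ha : ∀ i, 0 < a i) (b : ℝ) (f Y : ℝ → ℝ) (hfc : Continuous f) (hYc : Continuous Y)
    (hY : ∀ t ≤ b, Y t = 0) (hE : ∀ t, Y t = ∑ i, p i * Y (t - a i) + f t) (t : ℝ) :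
    ∑ i, p i * ∫ s in (t - a i)..t, Y s = ∫ s in b..t, f s := by
  have hi : ∀ u v, IntervalIntegrable Y volume u v := fun u v => hYc.intervalIntegrable u v
  have e1 : ∀ i, ∫ s in b..t, Y (s - a i) = ∫ s in b..(t - a i), Y s := by
    intro i
    rw [intervalIntegral.integral_comp_sub_right (fun s => Y s) (a i),
      ← intervalIntegral.integral_add_adjacent_intervals (hi (b - a i) b) (hi b (t - a i))]
    rw [intervalIntegral.integral_congr (g := fun _ => (0:ℝ)) (a := b - a i) (b := b)]
    · simp
    · intro s hs
      rw [Set.uIcc_of_le (by linarith [ha i])] at hs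
      exact hY s hs.2
  have e2 : ∫ s in b..t, Y s = (∑ i, p i * ∫ s in b..(t - a i), Y s) + ∫ s in b..t, f s := by
    calc ∫ s in b..t, Y s = ∫ s in b..t, (∑ i, p i * Y (s - a i) + f s) := by
          apply intervalIntegral.integral_congr; intro s _; exact hE s
      _ = _ := by
        rw [intervalIntegral.integral_add, intervalIntegral.integral_finsetSum]
        · congr 1
          apply Finset.sum_congr rfl
          intro i _
          rw [intervalIntegral.integral_const_mul, e1]
        · intro i _
          apply Continuous.intervalIntegrable; fun_prop
        · apply Continuous.intervalIntegrable; fun_prop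
        · apply Continuous.intervalIntegrable; fun_prop
  have e3 : ∀ i, ∫ s in (t - a i)..t, Y s = (∫ s in b..t, Y s) - ∫ s in b..(t - a i), Y s := by
    intro i
    rw [intervalIntegral.integral_interval_sub_left (hi _ _) (hi _ _)]
  simp only [e3, mul_sub, Finset.sum_sub_distrib, ← Finset.sum_mul, hp1]
  linarith

/-- asymptotic density of the semigroup -/
lemma rn_dense {ι : Type*} [Nonempty ι] (a : ι → ℝ) (ha : ∀ i, 0 < a i)
    (hd : Dense ((AddSubgroup.closure (Set.range a) : AddSubgroup ℝ) : Set ℝ))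
    (δ : ℝ) (hδ : 0 < δ) :
    ∃ L : ℝ, ∀ x, L ≤ x → ∃ s ∈ AddSubmonoid.closure (Set.range a), |x - s| ≤ δ := by
  set S := AddSubmonoid.closure (Set.range a) with hS
  obtain ⟨i0⟩ := ‹Nonempty ι›
  have haS : ∀ i, a i ∈ S := fun i => AddSubmonoid.subset_closure ⟨i, rfl⟩
  have hpos : ∀ s ∈ S, 0 ≤ s := by
    intro s hs
    induction hs using AddSubmonoid.closure_induction with
    | mem x hx => obtain ⟨i, rfl⟩ := hx; exact (ha i).le
    | zero => exact le_rfl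
    | add x y _ _ hx hy => exact add_nonneg hx hy
  have hdiff : ∀ g ∈ AddSubgroup.closure (Set.range a), ∃ u ∈ S, ∃ v ∈ S, g = u - v := by
    intro g hg
    induction hg using AddSubgroup.closure_induction with
    | mem x hx => exact ⟨x, AddSubmonoid.subset_closure hx, 0, zero_mem _, by simp⟩
    | zero => exact ⟨0, zero_mem _, 0, zero_mem _, by simp⟩
    | add x y _ _ hx hy =>
      obtain ⟨u, hu, v, hv, rfl⟩ := hx
      obtain ⟨u', hu', v', hv', rfl⟩ := hy
      exact ⟨u + u', add_mem hu hu', v + v', add_mem hv hv', by ring⟩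
    | neg x _ hx =>
      obtain ⟨u, hu, v, hv, rfl⟩ := hx
      exact ⟨v, hv, u, hu, by ring⟩
  obtain ⟨g, hg, hg0⟩ := hd.exists_mem_open isOpen_Ioo (⟨δ/2, by constructor <;> linarith⟩ :
    (Set.Ioo 0 δ).Nonempty)
  obtain ⟨u, hu, v, hv, rfl⟩ := hdiff g hg
  set g := u - v with hgd
  set w := v + a i0 with hw
  have hwS : w ∈ S := add_mem hv (haS i0)
  have hwgS : w + g ∈ S := by
    have : w + g = u + a i0 := by rw [hw, hgd]; ring
    rw [this]; exact add_mem hu (haS i0)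
  have hw0 : 0 < w := by linarith [hpos v hv, ha i0]
  have hgp : 0 < g := hg0.1
  obtain ⟨n, hn⟩ := exists_nat_ge (w / g)
  refine ⟨n * w, fun x hx => ?_⟩
  have hx0 : 0 ≤ x := le_trans (by positivity) hx
  set m := ⌊x / w⌋₊ with hm
  have hm1 : m * w ≤ x := by
    rw [← le_div_iff₀ hw0]; exact Nat.floor_le (by positivity)
  have hm2 : x < (m + 1) * w := by
    rw [← div_lt_iff₀ hw0]; exact Nat.lt_floor_add_one _
  have hnm : n ≤ m := Nat.le_floor (by rw [le_div_iff₀ hw0]; exact hx)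
  set k := ⌊(x - m * w) / g⌋₊ with hk
  have hk1 : k * g ≤ x - m * w := by
    rw [← le_div_iff₀ hgp]; exact Nat.floor_le (div_nonneg (by linarith) hgp.le)
  have hk2 : x - m * w < (k + 1) * g := by
    rw [← div_lt_iff₀ hgp]; exact Nat.lt_floor_add_one _
  have hkm : k ≤ m := by
    refine le_trans ?_ hnm
    have : (k : ℝ) ≤ n := by
      refine le_trans ?_ hn
      rw [le_div_iff₀ hgp]; linarith
    exact_mod_cast this
  refine ⟨(m - k) • w + k • (w + g), add_mem (nsmul_mem hwS _) (nsmul_mem hwgS _), ?_⟩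
  have : ((m - k) • w + k • (w + g) : ℝ) = m * w + k * g := by
    simp only [nsmul_eq_mul, Nat.cast_sub hkm]; ring
  rw [this, abs_le]
  constructor <;> linarith [hg0.2]

lemma rn_uc {ι : Type*} [Fintype ι] [Nonempty ι] (p a : ι → ℝ) (hp : ∀ i, 0 < p i)
    (hp1 : ∑ i, p i = 1)
    (a0 A : ℝ) (ha0 : 0 < a0) (ha : ∀ i, a0 ≤ a i) (hA : ∀ i, a i ≤ A) (γ b : ℝ) (hγ : 0 < γ)
    (c Λ : ℝ) (hc : 0 < c) (hΛ : 0 < Λ) (f Y : ℝ → ℝ)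
    (hfd : ∀ t, |f t| ≤ c * Real.exp (-γ * t))
    (hfL : ∀ x y, |f x - f y| ≤ Λ * |x - y|)
    (hY : ∀ t ≤ b, Y t = 0) (hE : ∀ t, Y t = ∑ i, p i * Y (t - a i) + f t) (ε : ℝ) (hε : 0 < ε) :
    ∃ δ > 0, ∀ x y, |x - y| ≤ δ → |Y x - Y y| ≤ ε := by
  obtain ⟨K, hK0, hK⟩ := rn_bound p a hp hp1 a0 A ha0 ha hA (γ/2) (b-1) (by positivity)
  have main : ∀ h, 0 ≤ h → h ≤ 1 → ∀ t, |Y (t + h) - Y t| ≤ K * Real.sqrt (2 * c * Λ * h) := by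
    intro h h0 h1 t
    refine hK (Real.sqrt (2 * c * Λ * h)) (fun t => f (t + h) - f t) (fun t => Y (t + h) - Y t)
      (Real.sqrt_nonneg _) ?_ ?_ ?_ t
    · intro t ht
      rw [hY t (by linarith), hY (t + h) (by linarith), sub_zero]
    · intro t _
      have b1 : |f (t + h) - f t| ≤ Λ * h := by
        have := hfL (t + h) t
        rwa [add_sub_cancel_left, abs_of_nonneg h0] at this
      have b2 : |f (t + h) - f t| ≤ 2 * c * Real.exp (-γ * t) := by
        have e1 := hfd (t + h)
        have e2 := hfd t
        have e3 : Real.exp (-γ * (t + h)) ≤ Real.exp (-γ * t) := by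
          apply Real.exp_le_exp.2; nlinarith
        have e4 := abs_sub (f (t + h)) (f t)
        nlinarith
      have b3 : Real.sqrt (2 * c * Λ * h) * Real.exp (-(γ/2) * t) = Real.sqrt ((Λ * h) * (2 * c * Real.exp (-γ * t))) := by
        have : Real.exp (-γ * t) = Real.exp (-(γ/2) * t) ^ 2 := by
          rw [← Real.exp_nat_mul]; congr 1; push_cast; ring
        rw [this, show (Λ * h) * (2 * c * Real.exp (-(γ/2) * t) ^ 2) = (2 * c * Λ * h) * Real.exp (-(γ/2) * t) ^ 2 by ring, Real.sqrt_mul (show 0 ≤ 2 * c * Λ * h by positivity), Real.sqrt_sq (Real.exp_pos _).le]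
      rw [b3]
      apply Real.le_sqrt_of_sq_le
      rw [sq]
      exact mul_le_mul b1 b2 (abs_nonneg _) (by positivity)
    · intro t _
      rw [hE (t + h), hE t]
      have : ∀ i, t + h - a i = t - a i + h := fun i => by ring
      simp only [this, mul_sub, Finset.sum_sub_distrib]
      ring
  have hlim : Tendsto (fun h => K * Real.sqrt (2 * c * Λ * h)) (nhds 0) (nhds 0) := by
    have : Continuous (fun h => K * Real.sqrt (2 * c * Λ * h)) := by fun_prop
    simpa using this.tendsto 0
  obtain ⟨δ, hδ, hh⟩ := Metric.eventually_nhds_iff.1 (hlim.eventually_lt_const hε)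
  refine ⟨min (δ/2) 1, by positivity, ?_⟩
  have key : ∀ x y, y ≤ x → |x - y| ≤ min (δ/2) 1 → |Y x - Y y| ≤ ε := by
    intro x y hxy hd
    rw [abs_of_nonneg (by linarith)] at hd
    have h1 := hd.trans (min_le_left _ _)
    have h2 := hd.trans (min_le_right _ _)
    have := main (x - y) (by linarith) h2 y
    rw [add_sub_cancel] at this
    refine this.trans (hh ?_).le
    rw [Real.dist_eq, sub_zero, abs_of_nonneg (by linarith)]; linarith
  intro x y hd
  rcases le_total y x with h | h
  · exact key x y h hd
  · rw [abs_sub_comm] at hd ⊢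
    exact key y x h hd

/-- upper bound for Lipschitz forcing -/
lemma rn_lip {ι : Type*} [Fintype ι] [Nonempty ι] (p a : ι → ℝ) (hp : ∀ i, 0 < p i)
    (hp1 : ∑ i, p i = 1)
    (a0 A : ℝ) (ha0 : 0 < a0) (ha : ∀ i, a0 ≤ a i) (hA : ∀ i, a i ≤ A) (γ b : ℝ) (hγ : 0 < γ)
    (hd : Dense ((AddSubgroup.closure (Set.range a) : AddSubgroup ℝ) : Set ℝ))
    (c Λ : ℝ) (hc : 0 < c) (hΛ : 0 < Λ) (f Y : ℝ → ℝ)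
    (hfd : ∀ t, |f t| ≤ c * Real.exp (-γ * t))
    (hfL : ∀ x y, |f x - f y| ≤ Λ * |x - y|) (hfc : Continuous f)
    (hfi : IntegrableOn f (Set.Ioi b))
    (hY : ∀ t ≤ b, Y t = 0) (hE : ∀ t, Y t = ∑ i, p i * Y (t - a i) + f t) (ε : ℝ) (hε : 0 < ε) :
    ∀ᶠ t in atTop, Y t < (∑ i, a i * p i)⁻¹ * (∫ t in Set.Ioi b, f t) + ε := by
  have huc := rn_uc p a hp hp1 a0 A ha0 ha hA γ b hγ c Λ hc hΛ f Y hfd hfL hY hE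
  have hapos : ∀ i, 0 < a i := fun i => lt_of_lt_of_le ha0 (ha i)
  have hYc : Continuous Y := by
    rw [Metric.continuous_iff]
    intro y e he
    obtain ⟨δ, hδ, h⟩ := huc (e/2) (by positivity)
    refine ⟨δ, hδ, fun x hx => ?_⟩
    rw [Real.dist_eq] at hx ⊢
    linarith [h x y hx.le]
  obtain ⟨K, hK0, hK⟩ := rn_bound p a hp hp1 a0 A ha0 ha hA γ b hγ
  have hYb : ∀ t, |Y t| ≤ K * c := hK c f Y hc.le hY (fun t _ => hfd t) (fun t _ => hE t)
  have hbdd : IsBoundedUnder (· ≤ ·) atTop Y :=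
    isBoundedUnder_of ⟨K * c, fun t => (le_abs_self _).trans (hYb t)⟩
  have hcob : IsCoboundedUnder (· ≤ ·) atTop Y :=
    IsBoundedUnder.isCoboundedUnder_le
      (isBoundedUnder_of ⟨-(K * c), fun t => (abs_le.1 (hYb t)).1⟩)
  set M := limsup Y atTop with hM
  have hup : ∀ e > 0, ∀ᶠ t in atTop, Y t < M + e := fun e he =>
    eventually_lt_of_limsup_lt (by linarith) hbdd
  have hcl : MapClusterPt M atTop Y := by
    rw [Metric.nhds_basis_ball.mapClusterPt_iff_frequently]
    intro e he
    have h1 : ∃ᶠ t in atTop, M - e < Y t := frequently_lt_of_lt_limsup hcob (by linarith)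
    refine (h1.and_eventually (hup e he)).mono ?_
    rintro t ⟨h1, h2⟩
    rw [Metric.mem_ball, Real.dist_eq, abs_lt]
    constructor <;> linarith
  obtain ⟨U, hU, hUM⟩ := mapClusterPt_iff_ultrafilter.1 hcl
  have hf0 : Tendsto f atTop (nhds 0) := by
    apply squeeze_zero_norm (a := fun t => c * Real.exp (-γ * t)) (fun t => hfd t)
    have : Tendsto (fun t : ℝ => Real.exp (-γ * t)) atTop (nhds 0) := by
      apply Real.tendsto_exp_atBot.comp
      exact tendsto_id.const_mul_atTop_of_neg (by linarith)
    simpa using this.const_mul c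
  have hshift : ∀ s : ℝ, Tendsto (fun t => t - s) U atTop := fun s =>
    (tendsto_atTop_add_const_right atTop (-s) tendsto_id).mono_left hU
  -- values propagate
  have hstep : ∀ s, (∀ e > 0, ∀ᶠ t in (U : Filter ℝ), M - e < Y (t - s)) → ∀ j,
      (∀ e > 0, ∀ᶠ t in (U : Filter ℝ), M - e < Y (t - (a j + s))) := by
    intro s hs j e he
    have hpj := hp j
    set e' := p j * e / 3 with he'
    have he'0 : 0 < e' := by positivity
    have hall : ∀ᶠ t in (U : Filter ℝ), ∀ i, Y (t - s - a i) < M + e' := by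
      rw [eventually_all]
      intro i
      have := (hshift (s + a i)).eventually (hup e' he'0)
      filter_upwards [this] with t ht
      rwa [← sub_sub] at ht
    have hf1 := (hshift s).eventually (hf0.eventually_lt_const he'0)
    filter_upwards [hs e' he'0, hall, hf1] with t h1 h2 h3
    have h4 : ∑ i, p i * (M + e' - Y (t - s - a i)) = M + e' - (Y (t - s) - f (t - s)) := by
      rw [hE (t - s)]
      simp only [mul_sub, Finset.sum_sub_distrib, ← Finset.sum_mul, hp1]
      ring
    have h5 : p j * (M + e' - Y (t - s - a j)) ≤ ∑ i, p i * (M + e' - Y (t - s - a i)) :=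
      Finset.single_le_sum (f := fun i => p i * (M + e' - Y (t - s - a i)))
        (fun i _ => mul_nonneg (hp i).le (by linarith [h2 i])) (Finset.mem_univ j)
    have h6 : t - (a j + s) = t - s - a j := by ring
    rw [h6]
    have h7 : p j * (M + e' - Y (t - s - a j)) < p j * e := by
      rw [h4] at h5
      have : p j * e = 3 * e' := by rw [he']; ring
      linarith
    have := lt_of_mul_lt_mul_left h7 hpj.le
    linarith
  have hsemi : ∀ s ∈ AddSubmonoid.closure (Set.range a),
      (∀ e > 0, ∀ᶠ t in (U : Filter ℝ), M - e < Y (t - s)) := by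
    intro s hs
    induction hs using AddSubmonoid.closure_induction_left with
    | zero =>
      intro e he
      simpa using hUM.eventually_const_lt (show M - e < M by linarith)
    | add_left x hx y hy ih =>
      obtain ⟨j, rfl⟩ := hx
      exact hstep y ih j
  have hη : 0 < ∑ i, a i * p i :=
    Finset.sum_pos (fun i _ => mul_pos (hapos i) (hp i)) Finset.univ_nonempty
  have hAp : 0 < A := by
    obtain ⟨i⟩ := ‹Nonempty ι›
    linarith [ha i, hA i]
  have hfin : ∀ e > 0, (∑ i, a i * p i) * (M - 2 * e) ≤ ∫ t in Set.Ioi b, f t := by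
    intro e he
    obtain ⟨δ, hδ, hδY⟩ := huc e he
    obtain ⟨L, hL⟩ := rn_dense a hapos hd (δ/2) (by positivity)
    obtain ⟨J, hJ⟩ := exists_nat_ge (A / (δ/2))
    have hch : ∀ j : ℕ, ∃ s ∈ AddSubmonoid.closure (Set.range a), |L + j * (δ/2) - s| ≤ δ/2 :=
      fun j => hL _ (by linarith [show 0 ≤ (j:ℝ) * (δ/2) by positivity])
    choose σ hσ1 hσ2 using hch
    have hgood : ∀ᶠ t in (U : Filter ℝ), ∀ j ∈ Finset.range (J+1), M - e < Y (t - σ j) := by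
      rw [eventually_all_finset]
      intro j _
      exact hsemi _ (hσ1 j) e he
    have hlow : ∀ᶠ t in (U : Filter ℝ),
        (∑ i, a i * p i) * (M - 2 * e) ≤ ∫ s in b..(t - L), f s := by
      filter_upwards [hgood] with t ht
      rw [← rn_cons p a hp1 hapos b f Y hfc hYc hY hE, Finset.sum_mul]
      apply Finset.sum_le_sum
      intro i _
      have hpt : ∀ s ∈ Set.Icc (t - L - a i) (t - L), M - 2 * e ≤ Y s := by
        intro s hs
        set x := t - L - s with hx
        have hx0 : 0 ≤ x := by linarith [hs.2]
        have hxA : x ≤ A := by linarith [hs.1, hA i]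
        set j := ⌊x / (δ/2)⌋₊ with hj
        have hj1 : j * (δ/2) ≤ x := by
          rw [← le_div_iff₀ (by positivity)]; exact Nat.floor_le (by positivity)
        have hj2 : x < (j + 1) * (δ/2) := by
          rw [← div_lt_iff₀ (by positivity)]; exact Nat.lt_floor_add_one _
        have hjJ : j ≤ J := by
          apply Nat.floor_le_of_le
          refine le_trans ?_ hJ
          gcongr
        have g1 := ht j (Finset.mem_range.2 (by omega))
        have g2 := abs_le.1 (hσ2 j)
        have g3 := hδY (t - σ j) s (by rw [abs_le]; constructor <;> linarith [g2.1, g2.2])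
        linarith [(abs_le.1 g3).2]
      have hle : t - L - a i ≤ t - L := by linarith [hapos i]
      have := intervalIntegral.integral_mono_on (μ := volume) hle
        (continuous_const.intervalIntegrable _ _) (hYc.intervalIntegrable _ _) hpt
      rw [intervalIntegral.integral_const, smul_eq_mul] at this
      have h8 : t - L - (t - L - a i) = a i := by ring
      rw [h8] at this
      calc a i * p i * (M - 2 * e) = p i * (a i * (M - 2 * e)) := by ring
        _ ≤ _ := mul_le_mul_of_nonneg_left this (hp i).le
    have hlim := (intervalIntegral_tendsto_integral_Ioi b hfi tendsto_id).comp (hshift L)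
    exact ge_of_tendsto hlim hlow
  have hMle : M ≤ (∑ i, a i * p i)⁻¹ * ∫ t in Set.Ioi b, f t := by
    apply le_of_forall_pos_le_add
    intro e he
    have := hfin (e/2) (by positivity)
    have h9 : M - 2 * (e/2) ≤ (∑ i, a i * p i)⁻¹ * ∫ t in Set.Ioi b, f t := by
      rw [inv_mul_eq_div, le_div_iff₀ hη]; linarith
    linarith
  filter_upwards [hup ε hε] with t ht
  linarith

/-- Lipschitz dominating profile -/
noncomputable def rnG (c γ t : ℝ) : ℝ := c * max 0 (min (t + 1) (Real.exp (-γ * max t 0)))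

lemma rnG_nonneg (c γ t : ℝ) (hc : 0 < c) : 0 ≤ rnG c γ t :=
  mul_nonneg hc.le (le_max_left _ _)

lemma rnG_zero (c γ t : ℝ) (ht : t ≤ -1) : rnG c γ t = 0 := by
  unfold rnG
  rw [max_eq_left, mul_zero]
  exact (min_le_left _ _).trans (by linarith)

lemma rnG_le (c γ t : ℝ) (hc : 0 < c) (hγ : 0 < γ) : rnG c γ t ≤ c * Real.exp (-γ * t) := by
  unfold rnG
  apply mul_le_mul_of_nonneg_left _ hc.le
  apply max_le (Real.exp_pos _).le
  refine (min_le_right _ _).trans (Real.exp_le_exp.2 ?_)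
  nlinarith [le_max_left t 0]

lemma rnG_eq (c γ t : ℝ) (hγ : 0 < γ) (ht : 0 < t) : rnG c γ t = c * Real.exp (-γ * t) := by
  unfold rnG
  rw [max_eq_left ht.le, min_eq_right, max_eq_right (Real.exp_pos _).le]
  have : Real.exp (-γ * t) ≤ 1 := Real.exp_le_one_iff.2 (by nlinarith)
  linarith

lemma rnG_lip (c γ : ℝ) (hc : 0 < c) (hγ : 0 < γ) (x y : ℝ) :
    rnG c γ x ≤ rnG c γ y + c * (1 + γ) * |x - y| := by
  have hexp : ∀ u v : ℝ, 0 ≤ u → 0 ≤ v → Real.exp (-u) ≤ Real.exp (-v) + |u - v| := by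
    intro u v hu hv
    rcases le_total v u with h | h
    · have : Real.exp (-u) ≤ Real.exp (-v) := Real.exp_le_exp.2 (by linarith)
      linarith [abs_nonneg (u - v)]
    · rw [abs_sub_comm, abs_of_nonneg (by linarith)]
      have h1 : Real.exp (-v) = Real.exp (-u) * Real.exp (u - v) := by
        rw [← Real.exp_add]; ring_nf
      have h2 := Real.add_one_le_exp (u - v)
      have h3 : Real.exp (-u) ≤ 1 := Real.exp_le_one_iff.2 (by linarith)
      have h4 := Real.exp_pos (-u)
      rw [h1]
      nlinarith
  have hmax : |max x 0 - max y 0| ≤ |x - y| := abs_max_sub_max_le_abs x y 0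
  have h1 : Real.exp (-γ * max x 0) ≤ Real.exp (-γ * max y 0) + γ * |x - y| := by
    have := hexp (γ * max x 0) (γ * max y 0) (by positivity) (by positivity)
    rw [← mul_sub, abs_mul, abs_of_pos hγ] at this
    simp only [neg_mul]
    nlinarith
  have h2 : x + 1 ≤ y + 1 + |x - y| := by linarith [le_abs_self (x - y)]
  have hn := abs_nonneg (x - y)
  have h3 : max 0 (min (x + 1) (Real.exp (-γ * max x 0)))
      ≤ max 0 (min (y + 1) (Real.exp (-γ * max y 0))) + (1 + γ) * |x - y| := by
    apply max_le
    · have := le_max_left 0 (min (y + 1) (Real.exp (-γ * max y 0)))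
      have : 0 ≤ (1 + γ) * |x - y| := by positivity
      linarith
    · have h4 := le_max_right 0 (min (y + 1) (Real.exp (-γ * max y 0)))
      refine le_trans ?_ (add_le_add_left h4 _)
      rw [← min_add_add_right]
      apply le_min
      · refine (min_le_left _ _).trans ?_
        nlinarith
      · refine (min_le_right _ _).trans ?_
        nlinarith
  unfold rnG
  nlinarith

/-- Lipschitz upper envelope -/
noncomputable def rnE (z : ℝ → ℝ) (n t : ℝ) : ℝ := ⨆ s, (z s - n * |t - s|)

lemma rnE_bdd (z : ℝ → ℝ) (B : ℝ) (hB : ∀ t, |z t| ≤ B) (n : ℝ) (hn : 0 ≤ n) (t : ℝ) :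
    BddAbove (Set.range fun s => z s - n * |t - s|) := by
  refine ⟨B, ?_⟩
  rintro _ ⟨s, rfl⟩
  have := (abs_le.1 (hB s)).2
  have : 0 ≤ n * |t - s| := by positivity
  simp only
  linarith

lemma rnE_ge (z : ℝ → ℝ) (B : ℝ) (hB : ∀ t, |z t| ≤ B) (n : ℝ) (hn : 0 ≤ n) (t : ℝ) :
    z t ≤ rnE z n t := by
  have := le_ciSup (rnE_bdd z B hB n hn t) t
  simpa [rnE] using this

lemma rnE_lip1 (z : ℝ → ℝ) (B : ℝ) (hB : ∀ t, |z t| ≤ B) (n : ℝ) (hn : 0 ≤ n) (x y : ℝ) :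
    rnE z n x ≤ rnE z n y + n * |x - y| := by
  apply ciSup_le
  intro s
  have h1 := le_ciSup (rnE_bdd z B hB n hn y) s
  have h2 : |y - s| ≤ |x - s| + |x - y| := by
    rw [abs_sub_comm x y, add_comm]; exact abs_sub_le y x s
  have h3 : n * |y - s| ≤ n * (|x - s| + |x - y|) := by gcongr
  unfold rnE
  linarith

lemma rnE_lip (z : ℝ → ℝ) (B : ℝ) (hB : ∀ t, |z t| ≤ B) (n : ℝ) (hn : 0 ≤ n) (x y : ℝ) :
    |rnE z n x - rnE z n y| ≤ n * |x - y| := by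
  rw [abs_le]
  have h1 := rnE_lip1 z B hB n hn x y
  have h2 := rnE_lip1 z B hB n hn y x
  rw [abs_sub_comm] at h2
  constructor <;> linarith

lemma rnE_le (z g : ℝ → ℝ) (n t : ℝ) (hzg : ∀ s, z s ≤ g s)
    (hg : ∀ x y, g x ≤ g y + n * |x - y|) : rnE z n t ≤ g t := by
  apply ciSup_le
  intro s
  have := hg s t
  rw [abs_sub_comm] at this
  linarith [hzg s]

lemma rnE_tendsto (z : ℝ → ℝ) (B : ℝ) (hB : ∀ t, |z t| ≤ B) (t : ℝ) (hz : ContinuousAt z t) :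
    Tendsto (fun n : ℕ => rnE z n t) atTop (nhds (z t)) := by
  rw [Metric.tendsto_atTop]
  intro ε hε
  obtain ⟨δ, hδ, h⟩ := Metric.continuousAt_iff.1 hz (ε/2) (by positivity)
  obtain ⟨m, hm⟩ := exists_nat_ge (2 * B / δ)
  refine ⟨m, fun n hn => ?_⟩
  have hnm : (m : ℝ) ≤ n := by exact_mod_cast hn
  have h1 := rnE_ge z B hB n (Nat.cast_nonneg n) t
  have h2 : rnE z n t ≤ z t + ε/2 := by
    apply ciSup_le
    intro s
    have hnn : 0 ≤ (n : ℝ) * |t - s| := by positivity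
    rcases lt_or_ge (dist s t) δ with hs | hs
    · have := h hs
      rw [Real.dist_eq, abs_lt] at this
      linarith [this.2]
    · rw [Real.dist_eq, abs_sub_comm] at hs
      have e1 := (abs_le.1 (hB s)).2
      have e2 := (abs_le.1 (hB t)).1
      rw [div_le_iff₀ hδ] at hm
      have e3 : (m : ℝ) * δ ≤ n * |t - s| := by gcongr
      linarith
  rw [Real.dist_eq, abs_lt]
  constructor <;> linarith

lemma rn_upper {ι : Type*} [Fintype ι] [Nonempty ι] (p a : ι → ℝ) (hp : ∀ i, 0 < p i)
    (hp1 : ∑ i, p i = 1)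
    (a0 A : ℝ) (ha0 : 0 < a0) (ha : ∀ i, a0 ≤ a i) (hA : ∀ i, a i ≤ A) (γ : ℝ) (hγ : 0 < γ)
    (hd : Dense ((AddSubgroup.closure (Set.range a) : AddSubgroup ℝ) : Set ℝ))
    (c : ℝ) (hc : 0 < c) (z Z : ℝ → ℝ) (B : ℝ) (hB : ∀ t, |z t| ≤ B)
    (hz0 : ∀ t ≤ (0 : ℝ), z t = 0)
    (hzdecay : ∀ t : ℝ, 0 < t → |z t| ≤ c * Real.exp (-γ * t))
    (hzcont : ∀ᵐ t : ℝ, ContinuousAt z t)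
    (hZ : ∀ t ≤ 0, Z t = 0) (hE : ∀ t, Z t = ∑ i, p i * Z (t - a i) + z t) (ε : ℝ) (hε : 0 < ε) :
    ∀ᶠ t in atTop, Z t < (∑ i, a i * p i)⁻¹ * (∫ t in Set.Ioi (0:ℝ), z t) + ε := by
  have hzg : ∀ t, |z t| ≤ rnG c γ t := by
    intro t
    rcases le_or_gt t 0 with h | h
    · rw [hz0 t h, abs_zero]; exact rnG_nonneg c γ t hc
    · rw [rnG_eq c γ t hγ h]; exact hzdecay t h
  obtain ⟨n0, hn0⟩ := exists_nat_ge (c * (1 + γ))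
  have hn0pos : (0:ℝ) < n0 := lt_of_lt_of_le (by positivity) hn0
  have hfg : ∀ n : ℕ, n0 ≤ n → ∀ t, |rnE z n t| ≤ rnG c γ t := by
    intro n hn t
    have hnn : (n0 : ℝ) ≤ n := by exact_mod_cast hn
    rw [abs_le]
    constructor
    · exact (abs_le.1 (hzg t)).1.trans (rnE_ge z B hB n (by positivity) t)
    · refine rnE_le z (rnG c γ) n t (fun s => (abs_le.1 (hzg s)).2) (fun x y => ?_)
      refine (rnG_lip c γ hc hγ x y).trans ?_
      have : c * (1 + γ) * |x - y| ≤ n * |x - y| := by gcongr; linarith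
      linarith
  have hcont : ∀ n : ℕ, Continuous (rnE z n) := by
    intro n
    have : LipschitzWith n (rnE z n) := LipschitzWith.of_dist_le_mul fun x y => by
      rw [Real.dist_eq, Real.dist_eq]
      simpa using rnE_lip z B hB n (Nat.cast_nonneg n) x y
    exact this.continuous
  have hexpi : IntegrableOn (fun t => c * Real.exp (-γ * t)) (Set.Ioi (-1)) :=
    (exp_neg_integrableOn_Ioi (-1) hγ).const_mul c
  have hlimI : Tendsto (fun n : ℕ => ∫ t in Set.Ioi (-1:ℝ), rnE z n t) atTop
      (nhds (∫ t in Set.Ioi (-1:ℝ), z t)) := by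
    apply tendsto_integral_filter_of_dominated_convergence (fun t => c * Real.exp (-γ * t))
    · exact Eventually.of_forall fun n => (hcont n).aestronglyMeasurable
    · filter_upwards [eventually_ge_atTop n0] with n hn
      exact Eventually.of_forall fun t => (hfg n hn t).trans (rnG_le c γ t hc hγ)
    · exact hexpi
    · filter_upwards [ae_restrict_of_ae hzcont] with t ht
      exact rnE_tendsto z B hB t ht
  have hI : ∫ t in Set.Ioi (-1:ℝ), z t = ∫ t in Set.Ioi (0:ℝ), z t := by
    apply setIntegral_eq_of_subset_of_forall_sdiff_eq_zero measurableSet_Ioi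
    · exact Set.Ioi_subset_Ioi (by norm_num)
    · intro t ht
      exact hz0 t (not_lt.1 ht.2)
  rw [hI] at hlimI
  have hlim2 := hlimI.const_mul (∑ i, a i * p i)⁻¹
  obtain ⟨n, hn1, hn2⟩ := ((hlim2.eventually_lt_const
    (show _ < (∑ i, a i * p i)⁻¹ * (∫ t in Set.Ioi (0:ℝ), z t) + ε/2 by linarith)).and
    (eventually_ge_atTop n0)).exists
  have hnpos : (0:ℝ) < n := lt_of_lt_of_le hn0pos (by exact_mod_cast hn2)
  have hf0 : ∀ t ≤ -1, rnE z n t = 0 := by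
    intro t ht
    have := hfg n hn2 t
    rw [rnG_zero c γ t ht] at this
    exact abs_nonpos_iff.1 this
  obtain ⟨Y, hY0, hYE⟩ := rn_exists p a a0 (-1) ha0 ha (rnE z n) hf0
  have hfd : ∀ t, |rnE z n t| ≤ c * Real.exp (-γ * t) :=
    fun t => (hfg n hn2 t).trans (rnG_le c γ t hc hγ)
  have hfi : IntegrableOn (rnE z n) (Set.Ioi (-1)) :=
    Integrable.mono' hexpi (hcont n).aestronglyMeasurable (Eventually.of_forall hfd)
  have hYlim := rn_lip p a hp hp1 a0 A ha0 ha hA γ (-1) hγ hd c n hc hnpos (rnE z n) Y hfd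
    (rnE_lip z B hB n hnpos.le) (hcont n) hfi hY0 hYE (ε/2) (by positivity)
  have hcmp := rn_cmp p a hp a0 A (-1) ha0 ha hA (fun t => Y t - Z t) ?_ ?_
  · filter_upwards [hYlim, eventually_ge_atTop (-1 - A)] with t h1 h2
    have := hcmp t h2
    linarith
  · intro t _ ht
    rw [hY0 t ht, hZ t (by linarith), sub_zero]
  · intro t _
    have e := rnE_ge z B hB n hnpos.le t
    have e2 := hYE t
    have e3 := hE t
    simp only [mul_sub, Finset.sum_sub_distrib]
    linarith


open MeasureTheory Filter

/-- the non-lattice case of Feller's renewal theorem for the renewal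
equation Z(t) = Σᵢ rᵢ^d Z(t − |ln rᵢ|) + z(t): if the |ln rᵢ| generate a dense
subgroup of ℝ, then Z(t) → (1/η) ∫₀^∞ z(t) dt as t → ∞, where
η = Σᵢ |ln rᵢ| rᵢ^d. -/
theorem renewal_theorem_nonlattice {N : ℕ} (hN : 1 ≤ N)
    (r : Fin N → ℝ) (hr : ∀ i, r i ∈ Set.Ioo (0 : ℝ) 1)
    (d : ℝ) (hd : ∑ i, (r i) ^ d = 1)
    (η : ℝ) (hη : η = ∑ i, |Real.log (r i)| * (r i) ^ d) (hηpos : 0 < η)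
    (Z z : ℝ → ℝ) (hZmeas : Measurable Z) (hzmeas : Measurable z)
    (hZ0 : ∀ t ≤ (0 : ℝ), Z t = 0) (hz0 : ∀ t ≤ (0 : ℝ), z t = 0)
    (hzbdd : ∃ Mb : ℝ, ∀ t, |z t| ≤ Mb)
    (c γ : ℝ) (hc : 0 < c) (hγ : 0 < γ)
    (hzdecay : ∀ t : ℝ, 0 < t → |z t| ≤ c * Real.exp (-γ * t))
    (hzcont : ∀ᵐ t : ℝ, ContinuousAt z t)
    (hrenewal : ∀ t : ℝ, Z t = (∑ i, (r i) ^ d * Z (t - |Real.log (r i)|)) + z t)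
    (hnonlattice : Dense
      ((AddSubgroup.closure (Set.range fun i => |Real.log (r i)|) : AddSubgroup ℝ) : Set ℝ)) :
    Tendsto Z atTop (nhds ((1 / η) * ∫ t in Set.Ioi (0 : ℝ), z t)) := by
  have : Nonempty (Fin N) := ⟨⟨0, by omega⟩⟩
  have hp : ∀ i, 0 < (r i) ^ d := fun i => Real.rpow_pos_of_pos (hr i).1 d
  have hapos : ∀ i, 0 < |Real.log (r i)| := fun i =>
    abs_pos.2 (Real.log_neg (hr i).1 (hr i).2).ne
  obtain ⟨i0, h0⟩ := Finite.exists_min (fun i => |Real.log (r i)|)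
  obtain ⟨i1, h1⟩ := Finite.exists_max (fun i => |Real.log (r i)|)
  obtain ⟨B, hB⟩ := hzbdd
  have hup := rn_upper (fun i => (r i) ^ d) (fun i => |Real.log (r i)|) hp hd _ _ (hapos i0) h0 h1
    γ hγ hnonlattice c hc z Z B hB hz0 hzdecay hzcont hZ0 hrenewal
  have hlo := rn_upper (fun i => (r i) ^ d) (fun i => |Real.log (r i)|) hp hd _ _ (hapos i0) h0 h1
    γ hγ hnonlattice c hc (fun t => -z t) (fun t => -Z t) B (fun t => by simpa using hB t)
    (fun t ht => by simp [hz0 t ht]) (fun t ht => by simpa using hzdecay t ht)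
    (by filter_upwards [hzcont] with t ht using ht.neg) (fun t ht => by simp [hZ0 t ht])
    (fun t => by
      simp only [mul_neg, Finset.sum_neg_distrib]
      linarith [hrenewal t])
  rw [← hη] at hup hlo
  rw [one_div, Metric.tendsto_nhds]
  intro ε hε
  filter_upwards [hup ε hε, hlo ε hε] with t h2 h3
  rw [integral_neg] at h3
  rw [Real.dist_eq, abs_lt]
  constructor <;> linarith
end
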